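/- The trigamma function $\psi'$ satisfies $[\psi''(x)]^2 / (\psi'''(x)\,\psi'(x)) > 1/2$ for all $x > 0$. -/

import Mathlib

/-- The digamma function `ψ = Γ'/Γ`, as the derivative of `log ∘ Γ` on `(0,∞)`. -/
noncomputable def digamma (x : ℝ) : ℝ := deriv (fun y => Real.log (Real.Gamma y)) x

/-- The trigamma function `ψ'`. -/
noncomputable def trigamma : ℝ → ℝ := deriv digamma

/-- `ψ''`. -/
noncomputable def digamma2 : ℝ → ℝ := deriv trigamma

/-- `ψ'''`. -/
noncomputable def digamma3 : ℝ → ℝ := deriv digamma2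

open Filter Topology Set

/-- The series `∑ (x + n)⁻ᵏ` (the Hurwitz zeta value `ζ(k, x)`). -/
noncomputable def hurwitzSeries (k : ℕ) (x : ℝ) : ℝ := ∑' n : ℕ, 1 / (x + n) ^ k

lemma summable_hurwitzSeries {k : ℕ} (hk : 2 ≤ k) {x : ℝ} (hx : 0 < x) :
    Summable fun n : ℕ => 1 / (x + n) ^ k := by
  have h := (Real.summable_one_div_nat_add_rpow x k).2 (by exact_mod_cast hk)
  refine h.congr fun n => ?_
  rw [Real.rpow_natCast, abs_of_pos (by positivity), add_comm]

lemma hurwitzSeries_pos {k : ℕ} (hk : 2 ≤ k) {x : ℝ} (hx : 0 < x) : 0 < hurwitzSeries k x :=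
  (summable_hurwitzSeries hk hx).tsum_pos (fun n => by positivity) 0 (by positivity)

lemma hurwitzSeries_eq_add {k : ℕ} (hk : 2 ≤ k) {x : ℝ} (hx : 0 < x) :
    hurwitzSeries k x = 1 / x ^ k + hurwitzSeries k (x + 1) := by
  rw [hurwitzSeries, (summable_hurwitzSeries hk hx).tsum_eq_zero_add, hurwitzSeries]
  simp only [Nat.cast_zero, add_zero, Nat.cast_add, Nat.cast_one]
  congr 1
  refine tsum_congr fun n => ?_
  ring_nf

lemma tendsto_hurwitzSeries {k : ℕ} (hk : 2 ≤ k) :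
    Tendsto (hurwitzSeries k) atTop (𝓝 0) := by
  have h := tendsto_tsum_of_dominated_convergence (𝓕 := atTop)
    (f := fun (x : ℝ) (n : ℕ) => 1 / (x + n) ^ k) (g := fun _ => 0)
    (summable_hurwitzSeries hk one_pos) (fun n => ?_) ?_
  · rwa [tsum_zero] at h
  · have : Tendsto (fun x : ℝ => (x + n) ^ k) atTop atTop :=
      (tendsto_pow_atTop (by omega)).comp (tendsto_atTop_add_const_right _ _ tendsto_id)
    simpa using! this.inv_tendsto_atTop
  · filter_upwards [eventually_ge_atTop 1] with x hx n
    rw [Real.norm_of_nonneg (by positivity)]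
    gcongr

lemma hasDerivAt_hurwitzSeries {k : ℕ} (hk : 2 ≤ k) {x : ℝ} (hx : 0 < x) :
    HasDerivAt (hurwitzSeries k) (-k * hurwitzSeries (k + 1) x) x := by
  have hsum := (summable_hurwitzSeries (k := k + 1) (by omega) (half_pos hx)).mul_left (k : ℝ)
  have h := hasDerivAt_tsum_of_isPreconnected (t := Ioi (x / 2)) (y := x) (y₀ := x)
    (g := fun (n : ℕ) (y : ℝ) => 1 / (y + n) ^ k)
    (g' := fun (n : ℕ) (y : ℝ) => -k * (1 / (y + n) ^ (k + 1))) hsum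
    isOpen_Ioi isPreconnected_Ioi (fun n y hy => ?_) (fun n y hy => ?_)
    (half_lt_self hx) (summable_hurwitzSeries hk hx) (half_lt_self hx)
  · rwa [tsum_mul_left] at h
  · have hy' : 0 < y := (half_pos hx).trans hy
    have hne : y + n ≠ 0 := by positivity
    obtain ⟨m, rfl⟩ : ∃ m, k = m + 1 := ⟨k - 1, by omega⟩
    have h1 := (((hasDerivAt_id y).add_const (n : ℝ)).pow (m + 1)).inv (pow_ne_zero (m + 1) hne)
    simp only [one_div]
    convert! h1 using 1
    simp
    field_simp
    ring
  · have hy' : x / 2 < y := hy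
    have hy0 : 0 < y := (half_pos hx).trans hy
    rw [norm_mul, norm_neg, Real.norm_natCast, Real.norm_of_nonneg (by positivity)]
    gcongr

/-- A function that decreases along unit steps and vanishes at infinity is nonnegative. -/
lemma nonneg_of_step_le {f : ℝ → ℝ} (hf : Tendsto f atTop (𝓝 0))
    (hstep : ∀ y, 0 < y → f (y + 1) ≤ f y) {x : ℝ} (hx : 0 < x) : 0 ≤ f x := by
  have hanti : Antitone fun n : ℕ => f (x + n) := antitone_nat_of_succ_le fun n => by
    have := hstep (x + n) (by positivity)
    rwa [Nat.cast_succ, ← add_assoc]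
  have hlim : Tendsto (fun n : ℕ => f (x + n)) atTop (𝓝 0) :=
    hf.comp (tendsto_atTop_add_const_left _ _ tendsto_natCast_atTop_atTop)
  simpa using hanti.le_of_tendsto hlim 0

lemma tendsto_const_div_pow_atTop (c : ℝ) {k : ℕ} (hk : k ≠ 0) :
    Tendsto (fun y : ℝ => c / y ^ k) atTop (𝓝 0) :=
  tendsto_const_nhds.div_atTop (tendsto_pow_atTop hk)

lemma hurwitzSeries_two_le {x : ℝ} (hx : 0 < x) :
    hurwitzSeries 2 x ≤ 1 / x ^ 1 + (1 / 2) / x ^ 2 + (1 / 6) / x ^ 3 := by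
  refine sub_nonneg.1 (nonneg_of_step_le
    (f := fun y => 1 / y ^ 1 + (1 / 2) / y ^ 2 + (1 / 6) / y ^ 3 - hurwitzSeries 2 y) ?_ ?_ hx)
  · simpa using (((tendsto_const_div_pow_atTop 1 one_ne_zero).add
      (tendsto_const_div_pow_atTop (1 / 2) two_ne_zero)).add
      (tendsto_const_div_pow_atTop (1 / 6) three_ne_zero)).sub (tendsto_hurwitzSeries le_rfl)
  · intro y hy
    rw [hurwitzSeries_eq_add le_rfl hy, ← sub_nonneg]
    have h : 0 ≤ 1 / (6 * y ^ 3 * (y + 1) ^ 3) := by positivity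
    convert! h using 1
    field_simp
    ring

lemma hurwitzSeries_four_le {x : ℝ} (hx : 0 < x) :
    hurwitzSeries 4 x ≤ (1 / 3) / x ^ 3 + (1 / 2) / x ^ 4 + (1 / 3) / x ^ 5 := by
  refine sub_nonneg.1 (nonneg_of_step_le
    (f := fun y => (1 / 3) / y ^ 3 + (1 / 2) / y ^ 4 + (1 / 3) / y ^ 5 - hurwitzSeries 4 y)
    ?_ ?_ hx)
  · simpa using (((tendsto_const_div_pow_atTop (1 / 3) three_ne_zero).add
      (tendsto_const_div_pow_atTop (1 / 2) four_ne_zero)).add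
      (tendsto_const_div_pow_atTop (1 / 3) (by norm_num : 5 ≠ 0))).sub
      (tendsto_hurwitzSeries (by norm_num : 2 ≤ 4))
  · intro y hy
    rw [hurwitzSeries_eq_add (by norm_num) hy, ← sub_nonneg]
    have h : 0 ≤ (2 + 7 * y + 7 * y ^ 2) / (6 * y ^ 5 * (y + 1) ^ 5) := by positivity
    convert! h using 1
    field_simp
    ring

lemma le_hurwitzSeries_three {x : ℝ} (hx : 0 < x) :
    (1 / 2) / x ^ 2 + (1 / 2) / x ^ 3 + (1 / 4) / x ^ 4 - (1 / 12) / x ^ 6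
      ≤ hurwitzSeries 3 x := by
  refine sub_nonneg.1 (nonneg_of_step_le
    (f := fun y => hurwitzSeries 3 y -
      ((1 / 2) / y ^ 2 + (1 / 2) / y ^ 3 + (1 / 4) / y ^ 4 - (1 / 12) / y ^ 6)) ?_ ?_ hx)
  · simpa using (tendsto_hurwitzSeries (by norm_num : 2 ≤ 3)).sub
      ((((tendsto_const_div_pow_atTop (1 / 2) two_ne_zero).add
      (tendsto_const_div_pow_atTop (1 / 2) three_ne_zero)).add
      (tendsto_const_div_pow_atTop (1 / 4) four_ne_zero)).sub
      (tendsto_const_div_pow_atTop (1 / 12) (by norm_num : 6 ≠ 0)))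
  · intro y hy
    rw [hurwitzSeries_eq_add (by norm_num) hy, ← sub_nonneg]
    have h : 0 ≤ (1 + 6 * y + 12 * y ^ 2 + 8 * y ^ 3) / (12 * y ^ 6 * (y + 1) ^ 6) := by positivity
    convert! h using 1
    field_simp
    ring

lemma hurwitzSeries_gap_step {x : ℝ} (hx : 0 < x) :
    4 * hurwitzSeries 3 (x + 1) ^ 2 - 3 * hurwitzSeries 2 (x + 1) * hurwitzSeries 4 (x + 1) <
      4 * hurwitzSeries 3 x ^ 2 - 3 * hurwitzSeries 2 x * hurwitzSeries 4 x := by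
  have hx1 : 0 < x + 1 := by positivity
  have h2 := hurwitzSeries_two_le hx1
  have h3 := le_hurwitzSeries_three hx1
  have h4 := hurwitzSeries_four_le hx1
  rw [hurwitzSeries_eq_add le_rfl hx, hurwitzSeries_eq_add (k := 3) (by norm_num) hx,
    hurwitzSeries_eq_add (k := 4) (by norm_num) hx]
  generalize hurwitzSeries 2 (x + 1) = s2 at *
  generalize hurwitzSeries 3 (x + 1) = s3 at *
  generalize hurwitzSeries 4 (x + 1) = s4 at *
  have key : 0 < 1 + 8 * x ^ 3 * s3 - 3 * x ^ 4 * s4 - 3 * x ^ 2 * s2 := by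
    have e2 := mul_le_mul_of_nonneg_left h2 (by positivity : 0 ≤ 3 * x ^ 2)
    have e3 := mul_le_mul_of_nonneg_left h3 (by positivity : 0 ≤ 8 * x ^ 3)
    have e4 := mul_le_mul_of_nonneg_left h4 (by positivity : 0 ≤ 3 * x ^ 4)
    have e : 0 < (1 + 6 * x + 10 * x ^ 2 + 41 / 6 * x ^ 3 + 3 * x ^ 4 + 1 / 2 * x ^ 5) /
        (x + 1) ^ 6 := by positivity
    have e' : (1 + 6 * x + 10 * x ^ 2 + 41 / 6 * x ^ 3 + 3 * x ^ 4 + 1 / 2 * x ^ 5) /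
        (x + 1) ^ 6 = 1 + 8 * x ^ 3 * ((1 / 2) / (x + 1) ^ 2 + (1 / 2) / (x + 1) ^ 3 +
          (1 / 4) / (x + 1) ^ 4 - (1 / 12) / (x + 1) ^ 6)
        - 3 * x ^ 4 * ((1 / 3) / (x + 1) ^ 3 + (1 / 2) / (x + 1) ^ 4 + (1 / 3) / (x + 1) ^ 5)
        - 3 * x ^ 2 * (1 / (x + 1) ^ 1 + (1 / 2) / (x + 1) ^ 2 + (1 / 6) / (x + 1) ^ 3) := by
      field_simp
      ring
    linarith
  rw [← sub_pos]
  have h : 0 < (1 + 8 * x ^ 3 * s3 - 3 * x ^ 4 * s4 - 3 * x ^ 2 * s2) / x ^ 6 := by positivity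
  convert! h using 1
  field_simp
  ring

lemma three_mul_hurwitzSeries_lt {x : ℝ} (hx : 0 < x) :
    3 * hurwitzSeries 2 x * hurwitzSeries 4 x < 4 * hurwitzSeries 3 x ^ 2 := by
  have hlim : Tendsto (fun y => 4 * hurwitzSeries 3 y ^ 2 -
      3 * hurwitzSeries 2 y * hurwitzSeries 4 y) atTop (𝓝 0) := by
    simpa using (((tendsto_hurwitzSeries (by norm_num : 2 ≤ 3)).pow 2).const_mul 4).sub
      (((tendsto_hurwitzSeries le_rfl).const_mul 3).mul
        (tendsto_hurwitzSeries (by norm_num : 2 ≤ 4)))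
  have h := nonneg_of_step_le hlim (fun y hy => (hurwitzSeries_gap_step hy).le)
    (by positivity : 0 < x + 1)
  linarith [hurwitzSeries_gap_step hx]

lemma hasDerivAt_log_Gamma {x : ℝ} (hx : 0 < x) :
    HasDerivAt (fun y => Real.log (Real.Gamma y)) (digamma x) x := by
  refine DifferentiableAt.hasDerivAt (DifferentiableAt.log (Real.differentiableAt_Gamma ?_)
    (Real.Gamma_pos_of_pos hx).ne')
  intro m
  have : (0 : ℝ) ≤ m := m.cast_nonneg
  linarith

lemma log_Gamma_add_one {x : ℝ} (hx : 0 < x) :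
    Real.log (Real.Gamma (x + 1)) = Real.log x + Real.log (Real.Gamma x) := by
  rw [Real.Gamma_add_one hx.ne', Real.log_mul hx.ne' (Real.Gamma_pos_of_pos hx).ne']

lemma digamma_add_one {x : ℝ} (hx : 0 < x) : digamma (x + 1) = digamma x + 1 / x := by
  have h1 := (hasDerivAt_log_Gamma (by positivity : 0 < x + 1)).comp_add_const x 1
  have h2 := (Real.hasDerivAt_log hx.ne').add (hasDerivAt_log_Gamma hx)
  have h3 := h1.unique (h2.congr_of_eventuallyEq
    (by filter_upwards [lt_mem_nhds hx] with y hy using log_Gamma_add_one hy))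
  rw [h3, one_div, add_comm]

lemma digamma_le_log {x : ℝ} (hx : 0 < x) : digamma x ≤ Real.log x := by
  have h := Real.convexOn_log_Gamma.le_slope_of_hasDerivAt (mem_Ioi.2 hx)
    (mem_Ioi.2 (by positivity : 0 < x + 1)) (lt_add_one x) (hasDerivAt_log_Gamma hx)
  simpa [slope_def_field, log_Gamma_add_one hx] using h

lemma log_sub_inv_le_digamma {x : ℝ} (hx : 0 < x) : Real.log x - 1 / x ≤ digamma x := by
  have hx1 : 0 < x + 1 := by positivity
  have h := Real.convexOn_log_Gamma.slope_le_of_hasDerivAt (mem_Ioi.2 hx)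
    (mem_Ioi.2 hx1) (lt_add_one x) (hasDerivAt_log_Gamma hx1)
  rw [digamma_add_one hx] at h
  simp [slope_def_field, log_Gamma_add_one hx] at h
  rw [one_div]
  linarith

lemma tendsto_digamma_sub_log : Tendsto (fun x => digamma x - Real.log x) atTop (𝓝 0) := by
  refine tendsto_of_tendsto_of_tendsto_of_le_of_le' (g := fun x : ℝ => -(1 / x ^ 1))
    (h := fun _ => 0) (by simpa using (tendsto_const_div_pow_atTop 1 one_ne_zero).neg)
    tendsto_const_nhds ?_ ?_
  · filter_upwards [eventually_gt_atTop 0] with x hx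
    rw [pow_one]
    linarith [log_sub_inv_le_digamma hx]
  · filter_upwards [eventually_gt_atTop 0] with x hx
    linarith [digamma_le_log hx]

lemma digamma_add_nat {x : ℝ} (hx : 0 < x) (N : ℕ) :
    digamma (x + N) = digamma x + ∑ n ∈ Finset.range N, 1 / (x + n) := by
  induction N with
  | zero => simp
  | succ N ih =>
    rw [Nat.cast_succ, ← add_assoc, digamma_add_one (by positivity), ih, Finset.sum_range_succ,
      add_assoc]

lemma summable_digamma_series {x : ℝ} (hx : 0 < x) :
    Summable fun n : ℕ => 1 / (1 + n : ℝ) - 1 / (x + n) := by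
  have hm : 0 < min 1 x := lt_min one_pos hx
  refine Summable.of_norm_bounded
    ((summable_hurwitzSeries le_rfl hm).mul_left |x - 1|) fun n => ?_
  have h1 : min 1 x + n ≤ 1 + n := by gcongr; exact min_le_left _ _
  have h2 : min 1 x + n ≤ x + n := by gcongr; exact min_le_right _ _
  have h0 : 0 < min 1 x + n := by positivity
  have he : 1 / (1 + n : ℝ) - 1 / (x + n) = (x - 1) * (1 / ((1 + n) * (x + n))) := by
    field_simp
    ring
  rw [he, norm_mul, Real.norm_eq_abs, Real.norm_of_nonneg (by positivity), sq]
  gcongr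

lemma digamma_eq_tsum {x : ℝ} (hx : 0 < x) :
    digamma x = digamma 1 + ∑' n : ℕ, (1 / (1 + n : ℝ) - 1 / (x + n)) := by
  have hdiff : Tendsto (fun y => digamma (y + (x - 1)) - digamma y) atTop (𝓝 0) := by
    have h1 := tendsto_digamma_sub_log.comp
      (tendsto_atTop_add_const_right atTop (x - 1) tendsto_id)
    have h2 := (h1.sub tendsto_digamma_sub_log).add (Real.tendsto_log_comp_add_sub_log (x - 1))
    simp only [sub_zero, add_zero] at h2
    refine h2.congr fun y => ?_
    simp only [Function.comp_apply, id]
    ring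
  have hdiffN := hdiff.comp
    (tendsto_atTop_add_const_left atTop (1 : ℝ) tendsto_natCast_atTop_atTop)
  have hsum := (summable_digamma_series hx).hasSum.tendsto_sum_nat
  have hlim := (hdiffN.add hsum).const_add (digamma 1)
  rw [zero_add] at hlim
  refine tendsto_nhds_unique (tendsto_const_nhds.congr fun N => ?_) hlim
  have e : (1 : ℝ) + N + (x - 1) = x + N := by ring
  simp only [Function.comp_apply, e, digamma_add_nat hx, digamma_add_nat one_pos,
    Finset.sum_sub_distrib]
  ring

lemma hasDerivAt_digamma {x : ℝ} (hx : 0 < x) :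
    HasDerivAt digamma (hurwitzSeries 2 x) x := by
  have h := hasDerivAt_tsum_of_isPreconnected (t := Ioi (x / 2)) (y := x) (y₀ := x)
    (g := fun (n : ℕ) (y : ℝ) => 1 / (1 + n : ℝ) - 1 / (y + n))
    (g' := fun (n : ℕ) (y : ℝ) => 1 / (y + n) ^ 2)
    (summable_hurwitzSeries le_rfl (half_pos hx))
    isOpen_Ioi isPreconnected_Ioi (fun n y hy => ?_) (fun n y hy => ?_)
    (half_lt_self hx) (summable_digamma_series hx) (half_lt_self hx)
  · refine (h.const_add (digamma 1)).congr_of_eventuallyEq ?_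
    filter_upwards [lt_mem_nhds hx] with y hy using digamma_eq_tsum hy
  · have hy' : 0 < y := (half_pos hx).trans hy
    have hne : y + n ≠ 0 := by positivity
    have h1 := (((hasDerivAt_id y).add_const (n : ℝ)).inv hne).const_sub (1 / (1 + n : ℝ))
    simp only [one_div] at h1 ⊢
    convert! h1 using 1
    simp [neg_div]
  · have hy' : x / 2 < y := hy
    have hy0 : 0 < y := (half_pos hx).trans hy
    rw [Real.norm_of_nonneg (by positivity)]
    gcongr

lemma trigamma_eq {x : ℝ} (hx : 0 < x) : trigamma x = hurwitzSeries 2 x :=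
  (hasDerivAt_digamma hx).deriv

lemma digamma2_eq {x : ℝ} (hx : 0 < x) : digamma2 x = -2 * hurwitzSeries 3 x := by
  have h : trigamma =ᶠ[𝓝 x] hurwitzSeries 2 := by
    filter_upwards [lt_mem_nhds hx] with y hy using trigamma_eq hy
  exact h.deriv_eq.trans (hasDerivAt_hurwitzSeries le_rfl hx).deriv

lemma digamma3_eq {x : ℝ} (hx : 0 < x) : digamma3 x = 6 * hurwitzSeries 4 x := by
  have h : digamma2 =ᶠ[𝓝 x] fun y => -2 * hurwitzSeries 3 y := by
    filter_upwards [lt_mem_nhds hx] with y hy using digamma2_eq hy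
  have h3 := (hasDerivAt_hurwitzSeries (by norm_num : 2 ≤ 3) hx).const_mul (-2)
  refine (h.deriv_eq.trans h3.deriv).trans ?_
  push_cast
  ring

theorem digamma_deriv_ratio_gt_half (x : ℝ) (hx : 0 < x) :
    (digamma2 x) ^ 2 / (digamma3 x * trigamma x) > 1 / 2 := by
  rw [digamma2_eq hx, digamma3_eq hx, trigamma_eq hx, gt_iff_lt]
  have h2 := hurwitzSeries_pos le_rfl hx
  have h4 := hurwitzSeries_pos (by norm_num : 2 ≤ 4) hx
  rw [lt_div_iff₀ (by positivity)]
  linarith [three_mul_hurwitzSeries_lt hx]
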